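/- arXiv:0908.4512 — 3 statements merged into one kernel-verified Lean document; each statement's English description precedes it below -/
import Mathlib

section
/- Let ω be a resonant direction in ℝ^d. The map (n,r) ↦ (n/|p_ω|)ν_ω + r, defined on the set of pairs (n,r) with n ∈ ℤ and r ∈ ω_n^⊥ (equivalently, on the disjoint union over [c] ∈ ℤ/|p_ω|²ℤ of [c]×ω_c^⊥), is well-defined and is a bijection onto ℤ^d. Moreover, the map h : ω^⊥ → ℤ/|p_ω|²ℤ defined by h(r) := [n] whenever r ∈ ω_n^⊥ is a well-defined group homomorphism whose kernel is ω_0^⊥ ⊂ ℤ^d; consequently, the quotient group ω^⊥/ω_0^⊥ is isomorphic to ℤ/|p_ω|²ℤ, and its elements are exactly the cosets ω_n^⊥ = r + ω_0^⊥ for any r ∈ ω_n^⊥. -/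
/-!
Setting (F. Macià, "High-frequency propagation for the Schrödinger equation on
the torus").

The flat torus `𝕋^d = ℝ^d/(2πℤ)^d` is modelled as `Fin d → AddCircle (2π)`; an
element `u ∈ L²(𝕋^d)` is represented by its sequence of Fourier coefficients
`û : ℤ^d → ℂ` (with respect to the orthonormal basis `ψ_k = (2π)^{-d/2} e^{ik·x}`),
and operators on `L²(γ_ω)` by their kernels (matrices) in the orthonormal basis
`φ_m^ω(s) = e^{ims/|p_ω|}/√(2π|p_ω|)`, `m ∈ ℤ`.
-/

noncomputable section

open MeasureTheory Filter
open scoped BigOperators ComplexConjugate Topology ENNReal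

namespace TorusSchrodinger

instance fact_two_pi_pos : Fact (0 < 2 * Real.pi) := ⟨by positivity⟩

/-- The lattice `ℤ^d` of Fourier frequencies. -/
abbrev Zd (d : ℕ) := Fin d → ℤ
/-- Euclidean space `ℝ^d` (the fibre of `T^*𝕋^d`). -/
abbrev Rd (d : ℕ) := Fin d → ℝ
/-- The standard flat torus `𝕋^d = ℝ^d/(2πℤ)^d`. -/
abbrev Td (d : ℕ) := Fin d → AddCircle (2 * Real.pi)
/-- The phase space `T^*𝕋^d ≅ 𝕋^d × ℝ^d`. -/
abbrev Phase (d : ℕ) := Td d × Rd d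

variable {d : ℕ}

/-- Inclusion of the lattice `ℤ^d` into `ℝ^d`. -/
def toRd (k : Zd d) : Rd d := fun i => (k i : ℝ)

/-- The canonical projection `ℝ^d → 𝕋^d`. -/
def torusProj (x : Rd d) : Td d := fun i => (x i : AddCircle (2 * Real.pi))

/-- The character `e^{i k·x}` on the torus `𝕋^d`. -/
def char (k : Zd d) (x : Td d) : ℂ := ∏ i, fourier (k i) (x i)

/-- Euclidean inner product of two lattice vectors. -/
def dotZ (k l : Zd d) : ℤ := ∑ i, k i * l i

/-- Euclidean inner product of a lattice vector with a vector of `ℝ^d`. -/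
def dotR (k : Zd d) (ξ : Rd d) : ℝ := ∑ i, (k i : ℝ) * ξ i

/-- The set `Ω` of resonant frequencies in `ℝ^d`. -/
def Omega (d : ℕ) : Set (Rd d) := {ξ | ∃ k : Zd d, k ≠ 0 ∧ dotR k ξ = 0}

/-- A resonant direction `ω ∈ 𝕎`, encoded by its primitive lattice vector `p_ω`:
the nonzero components of `p_ω` are coprime and its first nonzero component is
positive. -/
structure ResonantDir (d : ℕ) where
  p : Zd d
  ne : p ≠ 0
  gcd_one : Finset.univ.gcd (fun i => (p i).natAbs) = 1
  first_pos : ∀ i, (∀ j, j < i → p j = 0) → 0 ≤ p i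

/-- `|p_ω|²`, as an integer. -/
def ResonantDir.M (ω : ResonantDir d) : ℤ := dotZ ω.p ω.p

/-- Orthogonal projection of a lattice point onto the hyperplane `I_ω`. -/
def projPerp (ω : ResonantDir d) (k : Zd d) : Rd d :=
  toRd k - (((dotZ k ω.p : ℝ) / (ω.M : ℝ)) • toRd ω.p)

/-- The set `ω_n^⊥ ⊆ I_ω`: those `r` in the hyperplane `I_ω` with
`(n/|p_ω|)ν_ω + r ∈ ℤ^d` (note `(n/|p_ω|)ν_ω = (n/|p_ω|²) p_ω`). -/
def perpSet (ω : ResonantDir d) (n : ℤ) : Set (Rd d) :=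
  {r | dotR ω.p r = 0 ∧ ∃ k : Zd d, toRd k = ((n : ℝ) / (ω.M : ℝ)) • toRd ω.p + r}

/-! Kernels: operators on `L²(γ_ω)` are represented by their matrix in the
orthonormal basis `(φ_m^ω)_{m ∈ ℤ}`. -/

/-- Kernels of Hermitian operators. -/
def KerHermitian (K : ℤ → ℤ → ℂ) : Prop := ∀ m n, K n m = conj (K m n)

/-- Positive (semidefinite) kernels: the quadratic form is nonnegative on all
finitely supported vectors. -/
def KerPos (K : ℤ → ℤ → ℂ) : Prop :=
  ∀ v : ℤ →₀ ℂ, 0 ≤ (∑ m ∈ v.support, ∑ n ∈ v.support, conj (v m) * K m n * v n).re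

/-- Hilbert–Schmidt kernels. -/
def IsHSKer (K : ℤ → ℤ → ℂ) : Prop := Summable fun q : ℤ × ℤ => ‖K q.1 q.2‖ ^ 2

/-- Trace class kernels: products of two Hilbert–Schmidt kernels. -/
def IsTraceClassKer (K : ℤ → ℤ → ℂ) : Prop :=
  ∃ A B : ℤ → ℤ → ℂ, IsHSKer A ∧ IsHSKer B ∧ ∀ m n, K m n = ∑' j : ℤ, A m j * B j n

/-- Kernels of operators of operator norm at most 1. -/
def KerContraction (C : ℤ → ℤ → ℂ) : Prop :=
  ∀ v : ℤ →₀ ℂ, ∑' m : ℤ, ‖∑ n ∈ v.support, C m n * v n‖ ^ 2 ≤ ∑ n ∈ v.support, ‖v n‖ ^ 2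

/-- The trace norm `tr|K|` of a kernel, via duality with contractions. -/
def traceNorm (K : ℤ → ℤ → ℂ) : ℝ :=
  ⨆ C : {C : ℤ → ℤ → ℂ // KerContraction C}, ‖∑' q : ℤ × ℤ, K q.1 q.2 * C.1 q.2 q.1‖

/-- Truncation of a kernel to the square `[-N,N]²`. -/
def kerTrunc (N : ℕ) (C : ℤ → ℤ → ℂ) : ℤ → ℤ → ℂ := fun m n =>
  if m.natAbs ≤ N ∧ n.natAbs ≤ N then C m n else 0

/-- The operator norm of a kernel. -/
def kerOpNorm (C : ℤ → ℤ → ℂ) : ℝ :=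
  ⨆ v : {v : ℤ →₀ ℂ // ∑ n ∈ v.support, ‖v n‖ ^ 2 ≤ 1},
    Real.sqrt (∑' m : ℤ, ‖∑ n ∈ v.1.support, C m n * v.1 n‖ ^ 2)

/-- Kernels of compact operators: operator-norm limits of their finite truncations. -/
def KerCompact (C : ℤ → ℤ → ℂ) : Prop :=
  Tendsto (fun N : ℕ => kerOpNorm fun m n => C m n - kerTrunc N C m n) atTop (𝓝 0)

/-! Wigner distributions. -/

/-- Fourier coefficients of the solution at time `t` of the Schrödinger equation
`i∂_t u + (1/2)Δu = 0` on `𝕋^d` in terms of those of the initial datum. -/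
def schrodinger (t : ℝ) (u : Zd d → ℂ) : Zd d → ℂ := fun k =>
  Complex.exp (-Complex.I * (t : ℂ) * (((∑ i, ((k i : ℝ)) ^ 2 : ℝ)) : ℂ) / 2) * u k

/-- The pairing `⟨w_u^h, a⟩` of the Wigner distribution at scale `h` of (the
function with Fourier coefficients) `u` with a symbol `a` on `T^*𝕋^d`. -/
def wignerPair (u : Zd d → ℂ) (h : ℝ) (a : Phase d → ℂ) : ℂ :=
  (((2 * Real.pi) ^ d : ℝ) : ℂ)⁻¹ *
    ∑' q : Zd d × Zd d,
      u q.1 * conj (u q.2) *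
        ∫ x : Td d, a (x, (h / 2) • (toRd q.1 + toRd q.2)) * char (q.1 - q.2) x

/-- Test symbols `a ∈ C_c^∞(T^*𝕋^d)`. -/
def IsSymbol (a : Phase d → ℂ) : Prop :=
  Continuous a ∧ HasCompactSupport a ∧
    ContDiff ℝ (⊤ : ℕ∞) fun q : Rd d × Rd d => a (torusProj q.1, q.2)

/-- A sequence of data `(u_h)` in `L²(𝕋^d)` (given by their Fourier coefficients),
bounded in `L²`, with scales `h → 0⁺`. -/
structure WignerData (d : ℕ) where
  h : ℕ → ℝ
  u : ℕ → Zd d → ℂ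
  h_pos : ∀ n, 0 < h n
  h_lim : Tendsto h atTop (𝓝 0)
  bounded : ∃ C : ℝ, ∀ n, ∑' k, ‖u n k‖ ^ 2 ≤ C

/-- Extraction of a subsequence. -/
def WignerData.sub (D : WignerData d) (σ : ℕ → ℕ) (hσ : StrictMono σ) : WignerData d where
  h := D.h ∘ σ
  u := D.u ∘ σ
  h_pos n := D.h_pos (σ n)
  h_lim := D.h_lim.comp hσ.tendsto_atTop
  bounded := D.bounded.imp fun _C hC n => hC (σ n)

/-- The `h`-oscillation property:
`limsup_{h→0⁺} ∑_{|k| > R/h} |û_h(k)|² → 0` as `R → ∞`. -/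
def HOsc (D : WignerData d) : Prop :=
  Tendsto (fun R : ℝ =>
      limsup (fun n =>
        ∑' k : {k : Zd d // R ^ 2 < (∑ i, ((k i : ℝ)) ^ 2) * (D.h n) ^ 2}, ‖D.u n k.1‖ ^ 2)
        atTop)
    atTop (𝓝 0)

/-- `μ0` is the semiclassical (Wigner) measure of the sequence `(u_h)`:
`w_{u_h}^h(0,·) ⇀ μ0`. -/
def IsSemiclassical (D : WignerData d) (μ0 : Measure (Phase d)) : Prop :=
  ∀ a : Phase d → ℂ, IsSymbol a →
    Tendsto (fun n => wignerPair (D.u n) (D.h n) a) atTop (𝓝 (∫ q, a q ∂μ0))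

/-- `μ` is a time-averaged Wigner limit of the Schrödinger evolution of `(u_h)`. -/
def IsTimeAvgLimit (D : WignerData d) (μ : ℝ → Measure (Phase d)) : Prop :=
  ∀ a : Phase d → ℂ, IsSymbol a → ∀ φ : ℝ → ℂ, Integrable φ →
    Tendsto (fun n => ∫ t : ℝ, φ t * wignerPair (schrodinger t (D.u n)) (D.h n) a) atTop
      (𝓝 (∫ t : ℝ, φ t * ∫ q, a q ∂(μ t)))

/-! The resonant Wigner distribution and resonant Wigner measures. -/

/-- The pairing `tr ∫ b(ξ) R_u^h(ω, dξ)` of the resonant Wigner distribution of `u`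
at scale `h` in the resonant direction `ω` with an operator-valued test function
`b` (given by its kernel in the basis `(φ_m^ω)`).  The parametrisation
`k = (m/|p_ω|)ν_ω + r`, `j = (n/|p_ω|)ν_ω + r` (so `m = k·p_ω`, `n = j·p_ω`,
`r = projPerp ω k`) of pairs of frequencies with `k - j ∈ ℤ p_ω` is used. -/
def resPair (u : Zd d → ℂ) (h : ℝ) (ω : ResonantDir d) (b : Rd d → ℤ → ℤ → ℂ) : ℂ :=
  ∑' q : {q : Zd d × Zd d // ∃ l : ℤ, q.1 - q.2 = l • ω.p},
    u q.1.1 * conj (u q.1.2) * b (h • projPerp ω q.1.1) (dotZ q.1.2 ω.p) (dotZ q.1.1 ω.p)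

/-- A positive finite measure on `ℝ^d` with values in the trace-class operators on
`L²(γ_ω)`, represented (via the Radon–Nikodym theorem for operator-valued
measures) by its scalar trace measure `trMeas` and a measurable field `dens` of
positive Hermitian density matrices of unit trace (in the basis `(φ_m^ω)`). -/
structure OpMeasure (d : ℕ) where
  trMeas : Measure (Rd d)
  finite : IsFiniteMeasure trMeas
  dens : Rd d → ℤ → ℤ → ℂ
  meas : ∀ m n, Measurable fun ξ => dens ξ m n
  herm : ∀ ξ m n, dens ξ n m = conj (dens ξ m n)
  pos : ∀ ξ, KerPos (dens ξ)
  normalized : ∀ ξ, HasSum (fun m : ℤ => dens ξ m m) 1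

/-- The pairing `tr ∫ b(ξ) μ(dξ)` of an operator-valued measure with an
operator-valued test function. -/
def OpMeasure.trPair (M : OpMeasure d) (b : Rd d → ℤ → ℤ → ℂ) : ℂ :=
  ∫ ξ, (∑' q : ℤ × ℤ, b ξ q.2 q.1 * M.dens ξ q.1 q.2) ∂M.trMeas

/-- Test sections `b ∈ C_c(I_ω; K(L²(γ_ω)))`: continuous, compactly supported,
compact-operator-valued. -/
def IsOpTestField (b : Rd d → ℤ → ℤ → ℂ) : Prop :=
  Continuous b ∧ HasCompactSupport b ∧ ∀ ξ : Rd d, KerCompact (b ξ)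

/-- `μR` is a resonant Wigner measure of the sequence `(u_h)`: for every resonant
direction `ω` it is a positive trace-class-operator-valued measure concentrated
on `I_ω` whose matrix entries `(m,n)` vanish unless `m ≡ n (mod |p_ω|²)`, and
`tr ∫ b dR_{u_h}^h(ω,·) → tr ∫ b dμR(ω,·)` for all test sections `b`. -/
def IsResonantWignerMeasure (D : WignerData d) (μR : ResonantDir d → OpMeasure d) : Prop :=
  ∀ ω : ResonantDir d,
    (μR ω).trMeas {ξ | dotR ω.p ξ ≠ 0} = 0 ∧
    (∀ (ξ : Rd d) (m n : ℤ), ¬ (ω.M ∣ (m - n)) → (μR ω).dens ξ m n = 0) ∧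
    ∀ b : Rd d → ℤ → ℤ → ℂ, IsOpTestField b →
      Tendsto (fun n => resPair (D.u n) (D.h n) ω b) atTop (𝓝 ((μR ω).trPair b))

/-- The density matrix of `μ_R^t(ω,·) = e^{it∂_ω²/2} μ_R⁰(ω,·) e^{-it∂_ω²/2}`, the
solution of the density-matrix Schrödinger equation
`i∂_t μ_R^t = [-(1/2)∂_ω², μ_R^t]` on `γ_ω` with initial datum `μ_R⁰`. -/
def densT (M : OpMeasure d) (ω : ResonantDir d) (t : ℝ) (ξ : Rd d) (m n : ℤ) : ℂ :=
  Complex.exp (-Complex.I * (t : ℂ) * ((((m ^ 2 - n ^ 2 : ℤ) : ℝ) / (2 * (ω.M : ℝ)) : ℝ) : ℂ)) *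
    M.dens ξ m n

/-- The geodesic flow `φ_s(x,ξ) = (x + sξ, ξ)` on `T^*𝕋^d`. -/
def geoFlow (s : ℝ) (q : Phase d) : Phase d := (q.1 + torusProj (s • q.2), q.2)

/-- `g` is (a density of) the signed measure
`ρ_ω^t = E_ω(ρ̃_ω^t(·,ξ) − (2π|p_ω|)⁻¹ (tr μ_R^t(ω,ξ)) ds)` on `𝕋^d × I_ω`, where
`ρ̃_ω^t` is the trace density of `μ_R^t(ω,·)` and `E_ω` the extension operator:
`g` is characterised by its Fourier coefficients in `x`, which are supported on
the frequencies `l p_ω`, `l ≠ 0`, and are given there by the corresponding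
traces `∑_{m-n=l|p_ω|²} μ_R^t(ω,·)(m,n)` of the propagated measure. -/
def IsRhoDensity (M : OpMeasure d) (ω : ResonantDir d) (t : ℝ) (g : Phase d → ℝ) : Prop :=
  Integrable g ((volume : Measure (Td d)).prod M.trMeas) ∧
  (∀ l : ℤ, l ≠ 0 → ∀ φ : Rd d → ℂ, Continuous φ → HasCompactSupport φ →
    ∫ q : Phase d, char (l • ω.p) q.1 * φ q.2 * ((g q : ℝ) : ℂ)
        ∂((volume : Measure (Td d)).prod M.trMeas)
      = ∫ ξ : Rd d, φ ξ * ∑' n : ℤ, densT M ω t ξ (n - l * ω.M) n ∂M.trMeas) ∧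
  (∀ k : Zd d, (¬ ∃ l : ℤ, l ≠ 0 ∧ k = l • ω.p) → ∀ φ : Rd d → ℂ, Continuous φ →
    HasCompactSupport φ →
    ∫ q : Phase d, char k q.1 * φ q.2 * ((g q : ℝ) : ℂ)
        ∂((volume : Measure (Td d)).prod M.trMeas) = 0)

/-- The signed measure `ρ_ω^t` on `T^*𝕋^d` associated to a density `g` (with
respect to `dx ⊗ tr μ_R(ω,·)`). -/
def rhoMeas (M : OpMeasure d) (g : Phase d → ℝ) : SignedMeasure (Phase d) :=
  ((volume : Measure (Td d)).prod M.trMeas).withDensityᵥ g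

/-! Symbols, `k_{a,φ}`, `K_b`, position densities, wave packets. -/

/-- The `k`-th Fourier coefficient in `x` of a symbol `a(x,ξ)` on `T^*𝕋^d`:
`a_k(ξ) = ∫_{𝕋^d} a(x,ξ) conj(ψ_k(x)) dx`. -/
def symbCoeff (a : Phase d → ℂ) (k : Zd d) (ξ : Rd d) : ℂ :=
  ((Real.sqrt ((2 * Real.pi) ^ d) : ℝ) : ℂ)⁻¹ * ∫ x : Td d, a (x, ξ) * conj (char k x)

/-- The Fourier transform `φ̂(s) = ∫ φ(t) e^{-its} dt`. -/
def phiHat (φ : ℝ → ℂ) (s : ℝ) : ℂ :=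
  ∫ t : ℝ, φ t * Complex.exp (-Complex.I * (t : ℂ) * (s : ℂ))

/-- The kernel (in the basis `(φ_m^ω)`) of the operator `k_{a,φ}(ω,ξ)` on
`L²(γ_ω)`. -/
def kerKaphi (a : Phase d → ℂ) (φ : ℝ → ℂ) (ω : ResonantDir d) (ξ : Rd d) (m n : ℤ) : ℂ :=
  if m ≠ n ∧ ω.M ∣ (m - n) then
    ((Real.sqrt ((2 * Real.pi) ^ d) : ℝ) : ℂ)⁻¹ *
      phiHat φ (((n ^ 2 - m ^ 2 : ℤ) : ℝ) / (2 * (ω.M : ℝ))) *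
      symbCoeff a (((m - n) / ω.M) • ω.p) ξ
  else 0

/-- The kernel (in the basis `(φ_m^ω)`) of the operator
`K_b = ∫_{I_ω} b(ξ) R_u^h(ω,dξ)` on `L²(γ_ω)`: for `m ≡ n (mod |p_ω|²)`,
`k_b(m,n) = ∑_{r ∈ ω_c^⊥} b(hr) û((m/|p_ω|)ν_ω+r) conj(û((n/|p_ω|)ν_ω+r))`, using
the parametrisation of `ω_m^⊥` by `{k ∈ ℤ^d : k·p_ω = m}`. -/
def kerKb (u : Zd d → ℂ) (h : ℝ) (ω : ResonantDir d) (b : Rd d → ℂ) (m n : ℤ) : ℂ :=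
  if ω.M ∣ (n - m) then
    ∑' k : {k : Zd d // dotZ k ω.p = m},
      b (h • projPerp ω k.1) * u k.1 * conj (u (k.1 + ((n - m) / ω.M) • ω.p))
  else 0

/-- The pairing `∫_{𝕋^d} m(x) |u(x)|² dx` of a position density with a test
function `m`. -/
def posDenPair (u : Zd d → ℂ) (m : Td d → ℂ) : ℂ :=
  (((2 * Real.pi) ^ d : ℝ) : ℂ)⁻¹ *
    ∑' q : Zd d × Zd d, u q.1 * conj (u q.2) * ∫ x : Td d, m x * char (q.1 - q.2) x

/-- Fourier coefficients of the `2πℤ^d`-periodisation of the wave packet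
`h^{-d/4} ρ((x-x₀)/√h) e^{iξ₀·x/h}` (for `ρ` supported in `(-π,π)^d`). -/
def wavePacket (ρ : Rd d → ℂ) (x₀ ξ₀ : Rd d) (h : ℝ) (k : Zd d) : ℂ :=
  ((Real.sqrt ((2 * Real.pi) ^ d) : ℝ) : ℂ)⁻¹ *
    ∫ x : Rd d, ((h ^ (-(d : ℝ) / 4) : ℝ) : ℂ) * ρ (fun i => (x i - x₀ i) / Real.sqrt h) *
      Complex.exp (Complex.I * ((∑ i, (ξ₀ i / h - (k i : ℝ)) * x i : ℝ) : ℂ))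

/-- Fourier coefficients of the `2πℤ^d`-periodisation of `ρ(x) e^{iξ₀·x/h}` (for
`ρ` supported in `(-π,π)^d`). -/
def oscData (ρ : Rd d → ℂ) (ξ₀ : Rd d) (h : ℝ) (k : Zd d) : ℂ :=
  ((Real.sqrt ((2 * Real.pi) ^ d) : ℝ) : ℂ)⁻¹ *
    ∫ x : Rd d, ρ x * Complex.exp (Complex.I * ((∑ i, (ξ₀ i / h - (k i : ℝ)) * x i : ℝ) : ℂ))

/-- The solution `e^{itΔ/2} ρ_per` on `𝕋^d`, where `ρ_per` is the
`2πℤ^d`-periodisation of `ρ`. -/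
def evolvedPer (ρ : Rd d → ℂ) (t : ℝ) (x : Td d) : ℂ :=
  ((Real.sqrt ((2 * Real.pi) ^ d) : ℝ) : ℂ)⁻¹ *
    ∑' k : Zd d,
      Complex.exp (-Complex.I * (t : ℂ) * ((∑ i, ((k i : ℝ)) ^ 2 : ℝ) : ℂ) / 2) *
        oscData ρ 0 1 k * char k x

/-- Euclidean norm on `ℝ^d`. -/
def euclNorm (ξ : Rd d) : ℝ := Real.sqrt (∑ i, ξ i ^ 2)

/-- The length `L` of the periodic geodesic of `𝕋^d` issued from `(x, ξ₀)`: the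
least `l > 0` such that `l·ξ₀/|ξ₀| ∈ 2πℤ^d`. -/
def geoLen (ξ₀ : Rd d) : ℝ :=
  sInf {l : ℝ | 0 < l ∧ ∃ k : Zd d, (l / euclNorm ξ₀) • ξ₀ = (2 * Real.pi) • toRd k}

/-- The average `⟨f⟩_{ξ₀}(x) = (|ξ₀|/L)∫_0^{L/|ξ₀|} f(x+sξ₀) ds` along the closed
geodesic in the direction `ξ₀`. -/
def geoAvg (f : Td d → ℝ) (ξ₀ : Rd d) (x : Td d) : ℝ :=
  euclNorm ξ₀ / geoLen ξ₀ *
    ∫ s in Set.Ioc (0 : ℝ) (geoLen ξ₀ / euclNorm ξ₀), f (x + torusProj (s • ξ₀))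

theorem dotR_add (k : Zd d) (ξ η : Rd d) : dotR k (ξ + η) = dotR k ξ + dotR k η := by
  simp [dotR, mul_add, Finset.sum_add_distrib]

theorem dotR_smul (k : Zd d) (a : ℝ) (ξ : Rd d) : dotR k (a • ξ) = a * dotR k ξ := by
  simp [dotR, Finset.mul_sum, mul_left_comm]

theorem dotR_toRd (k l : Zd d) : dotR k (toRd l) = (dotZ k l : ℝ) := by
  simp [dotR, dotZ, toRd]

theorem dotZ_smul_right (k : Zd d) (n : ℤ) (l : Zd d) : dotZ k (n • l) = n * dotZ k l := by
  simp [dotZ, Finset.mul_sum, mul_left_comm]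

theorem toRd_add (k l : Zd d) : toRd (k + l) = toRd k + toRd l := by
  ext i; simp [toRd]

theorem toRd_smul (n : ℤ) (k : Zd d) : toRd (n • k) = (n : ℝ) • toRd k := by
  ext i; simp [toRd]

namespace ResonantDir

variable (ω : ResonantDir d)

theorem M_pos : 0 < ω.M := by
  obtain ⟨i, hi⟩ := Function.ne_iff.mp ω.ne
  exact Finset.sum_pos' (fun j _ => mul_self_nonneg _) ⟨i, Finset.mem_univ i, mul_self_pos.mpr hi⟩

theorem M_cast_ne_zero : (ω.M : ℝ) ≠ 0 := by
  exact_mod_cast ω.M_pos.ne'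

theorem intCast_zmod_eq_iff (m n : ℤ) :
    (m : ZMod ω.M.toNat) = (n : ZMod ω.M.toNat) ↔ ω.M ∣ n - m := by
  rw [ZMod.intCast_eq_intCast_iff_dvd_sub, Int.toNat_of_nonneg ω.M_pos.le]

/-- Bézout's identity for the coprime components of `p_ω`. -/
theorem exists_dotZ_eq_one : ∃ a : Zd d, dotZ a ω.p = 1 := by
  have h : Ideal.span (Set.range ω.p) = ⊤ := by
    obtain ⟨g, hg⟩ := IsPrincipalIdealRing.principal (Ideal.span (Set.range ω.p))
    have hdvd (i : Fin d) : g ∣ ω.p i := by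
      have hi : ω.p i ∈ Ideal.span (Set.range ω.p) := Ideal.subset_span ⟨i, rfl⟩
      rwa [hg, Ideal.submodule_span_eq, Ideal.mem_span_singleton] at hi
    have h1 : g.natAbs ∣ 1 := by
      rw [← ω.gcd_one]
      exact Finset.dvd_gcd fun i _ => Int.natAbs_dvd_natAbs.mpr (hdvd i)
    rw [hg, Ideal.submodule_span_eq, Ideal.span_singleton_eq_top, Int.isUnit_iff_natAbs_eq]
    exact Nat.dvd_one.mp h1
  obtain ⟨a, ha⟩ := Ideal.mem_span_range_iff_exists_fun.mp ((Ideal.eq_top_iff_one _).mp h)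
  exact ⟨a, ha⟩

end ResonantDir

section PerpSet

variable {ω : ResonantDir d} {m n : ℤ} {r s : Rd d}

/-- If `r ⟂ p_ω`, the coefficient of `p_ω` in the decomposition of `k` is `p_ω·k/|p_ω|²`. -/
theorem dotZ_eq_of_toRd_eq (hr : dotR ω.p r = 0) {k : Zd d}
    (hk : toRd k = ((n : ℝ) / (ω.M : ℝ)) • toRd ω.p + r) : dotZ ω.p k = n := by
  have h := congrArg (dotR ω.p) hk
  rw [dotR_add, dotR_smul, dotR_toRd, dotR_toRd, hr, add_zero] at h
  change (dotZ ω.p k : ℝ) = (n : ℝ) / ω.M * (ω.M : ℝ) at h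
  rw [div_mul_cancel₀ _ ω.M_cast_ne_zero] at h
  exact_mod_cast h

theorem mem_perpSet_of_toRd_eq {k : Zd d} (hn : dotZ ω.p k = n)
    (hk : toRd k = ((n : ℝ) / (ω.M : ℝ)) • toRd ω.p + r) : r ∈ perpSet ω n := by
  refine ⟨?_, k, hk⟩
  have h := congrArg (dotR ω.p) hk
  rw [dotR_add, dotR_smul, dotR_toRd, dotR_toRd, hn] at h
  change (n : ℝ) = (n : ℝ) / ω.M * (ω.M : ℝ) + _ at h
  rw [div_mul_cancel₀ _ ω.M_cast_ne_zero] at h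
  linarith

theorem add_mem_perpSet (hr : r ∈ perpSet ω m) (hs : s ∈ perpSet ω n) :
    r + s ∈ perpSet ω (m + n) := by
  obtain ⟨hr, k, hk⟩ := hr
  obtain ⟨hs, l, hl⟩ := hs
  refine ⟨by rw [dotR_add, hr, hs, add_zero], k + l, ?_⟩
  rw [toRd_add, hk, hl]
  push_cast
  module

theorem neg_mem_perpSet (hr : r ∈ perpSet ω n) : -r ∈ perpSet ω (-n) := by
  obtain ⟨hr, k, hk⟩ := hr
  refine ⟨by rw [← neg_one_smul ℝ r, dotR_smul, hr, mul_zero], (-1 : ℤ) • k, ?_⟩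
  rw [toRd_smul, hk]
  push_cast
  module

theorem zero_mem_perpSet_mul (c : ℤ) : (0 : Rd d) ∈ perpSet ω (ω.M * c) := by
  refine ⟨by simp [dotR], c • ω.p, ?_⟩
  rw [toRd_smul, add_zero, Int.cast_mul, mul_div_cancel_left₀ _ ω.M_cast_ne_zero]

theorem perpSet_eq_of_dvd (h : ω.M ∣ n - m) : perpSet ω m = perpSet ω n := by
  obtain ⟨c, hc⟩ := h
  ext r
  constructor <;> intro hr
  · have := add_mem_perpSet hr (zero_mem_perpSet_mul c)
    rwa [add_zero, ← hc, add_sub_cancel] at this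
  · have := add_mem_perpSet hr (zero_mem_perpSet_mul (-c))
    rwa [add_zero, mul_neg, ← hc, neg_sub, add_sub_cancel] at this

theorem dvd_sub_of_mem_perpSet (hm : r ∈ perpSet ω m) (hn : r ∈ perpSet ω n) :
    ω.M ∣ n - m := by
  obtain ⟨-, k, hk⟩ := add_mem_perpSet hn (neg_mem_perpSet hm)
  obtain ⟨a, ha⟩ := ω.exists_dotZ_eq_one
  refine ⟨dotZ a k, ?_⟩
  have h := congrArg (dotR a) hk
  rw [add_neg_cancel, add_zero, dotR_smul, dotR_toRd, dotR_toRd, ha, Int.cast_one, mul_one,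
    eq_div_iff ω.M_cast_ne_zero] at h
  rw [sub_eq_add_neg, mul_comm]
  exact_mod_cast h.symm

theorem perpSet_nonempty (ω : ResonantDir d) (n : ℤ) : (perpSet ω n).Nonempty := by
  obtain ⟨a, ha⟩ := ω.exists_dotZ_eq_one
  have hn : dotZ ω.p (n • a) = n := by
    rw [dotZ_smul_right, show dotZ ω.p a = dotZ a ω.p from dotProduct_comm _ _, ha, mul_one]
  exact ⟨_, mem_perpSet_of_toRd_eq hn (add_sub_cancel _ _).symm⟩

theorem perpSet_zero_subset (ω : ResonantDir d) : perpSet ω 0 ⊆ Set.range (toRd (d := d)) := by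
  rintro r ⟨-, k, hk⟩
  exact ⟨k, by simpa using hk⟩

theorem perpSet_eq_image_add (hr : r ∈ perpSet ω n) :
    perpSet ω n = (fun s => r + s) '' perpSet ω 0 := by
  ext t
  constructor
  · intro ht
    refine ⟨-r + t, ?_, add_neg_cancel_left r t⟩
    simpa using add_mem_perpSet (neg_mem_perpSet hr) ht
  · rintro ⟨s, hs, rfl⟩
    simpa using add_mem_perpSet hr hs

theorem bijOn_perpSet (ω : ResonantDir d) :
    Set.BijOn (fun q : ℤ × Rd d => ((q.1 : ℝ) / (ω.M : ℝ)) • toRd ω.p + q.2)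
      {q : ℤ × Rd d | q.2 ∈ perpSet ω q.1} (Set.range (toRd (d := d))) := by
  refine ⟨fun q hq => hq.2, ?_, ?_⟩
  · rintro ⟨m, r⟩ ⟨hr, k, hk⟩ ⟨n, s⟩ ⟨hs, -⟩ h
    dsimp only at hr hk hs h
    obtain rfl : m = n :=
      (dotZ_eq_of_toRd_eq hr hk).symm.trans (dotZ_eq_of_toRd_eq hs (hk.trans h))
    rw [add_left_cancel h]
  · rintro _ ⟨k, rfl⟩
    exact ⟨(dotZ ω.p k, toRd k - ((dotZ ω.p k : ℝ) / (ω.M : ℝ)) • toRd ω.p),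
      mem_perpSet_of_toRd_eq rfl (add_sub_cancel _ _).symm, add_sub_cancel _ _⟩

end PerpSet

/-- Proposition 2: the map `(n,r) ↦ (n/|p_ω|)ν_ω + r`, defined
on the pairs `(n, r)` with `r ∈ ω_n^⊥`, is a bijection onto `ℤ^d`; the map
`h : ω^⊥ → ℤ/|p_ω|²ℤ`, `h(r) = [n]` for `r ∈ ω_n^⊥`, is a well-defined group
homomorphism with kernel `ω_0^⊥ ⊆ ℤ^d`; consequently `ω^⊥/ω_0^⊥ ≅ ℤ/|p_ω|²ℤ`,
the cosets being exactly the sets `ω_n^⊥ = r + ω_0^⊥`, `r ∈ ω_n^⊥`. -/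
theorem statement4 {d : ℕ} (ω : ResonantDir d) :
    Set.BijOn (fun q : ℤ × Rd d => ((q.1 : ℝ) / (ω.M : ℝ)) • toRd ω.p + q.2)
      {q : ℤ × Rd d | q.2 ∈ perpSet ω q.1} (Set.range (toRd (d := d))) ∧
    (∀ m n : ℤ, ∀ r : Rd d, r ∈ perpSet ω m → r ∈ perpSet ω n →
      (m : ZMod ω.M.toNat) = (n : ZMod ω.M.toNat)) ∧
    (∀ m n : ℤ, ∀ r s : Rd d, r ∈ perpSet ω m → s ∈ perpSet ω n →
      r + s ∈ perpSet ω (m + n)) ∧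
    (∀ r : Rd d, (∃ n : ℤ, r ∈ perpSet ω n ∧ (n : ZMod ω.M.toNat) = 0) ↔
      r ∈ perpSet ω 0) ∧
    perpSet ω 0 ⊆ Set.range (toRd (d := d)) ∧
    (∀ n : ℤ, ∀ r ∈ perpSet ω n, perpSet ω n = (fun s => r + s) '' perpSet ω 0) ∧
    (∀ c : ZMod ω.M.toNat, ∃ n : ℤ, (n : ZMod ω.M.toNat) = c ∧ (perpSet ω n).Nonempty) := by
  refine ⟨bijOn_perpSet ω, ?_, fun m n r s => add_mem_perpSet, ?_, perpSet_zero_subset ω,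
    fun n r => perpSet_eq_image_add, ?_⟩
  · intro m n r hm hn
    exact (ω.intCast_zmod_eq_iff m n).mpr (dvd_sub_of_mem_perpSet hm hn)
  · intro r
    refine ⟨?_, fun hr => ⟨0, hr, Int.cast_zero⟩⟩
    rintro ⟨n, hr, hn⟩
    rw [← Int.cast_zero, ω.intCast_zmod_eq_iff] at hn
    rwa [← perpSet_eq_of_dvd hn]
  · intro c
    obtain ⟨n, hn⟩ := ZMod.intCast_surjective c
    exact ⟨n, hn, perpSet_nonempty ω n⟩

end TorusSchrodinger
end
end

section
/- Let u ∈ L²(𝕋^d), h > 0, ω a resonant direction, and b a bounded function on I_ω. For m ≡ n (mod |p_ω|²), say m, n ∈ [c], set k_b(m,n) := Σ_{r∈ω_c^⊥} b(hr) û((m/|p_ω|)ν_ω+r) conj(û((n/|p_ω|)ν_ω+r)). Then Σ_{m≡n (mod |p_ω|²)} |k_b(m,n)|² ≤ ‖b‖²_{L^∞(I_ω)} ‖u‖⁴_{L²(𝕋^d)}. -/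
/-!
Setting (F. Macià, "High-frequency propagation for the Schrödinger equation on
the torus").

The flat torus `𝕋^d = ℝ^d/(2πℤ)^d` is modelled as `Fin d → AddCircle (2π)`; an
element `u ∈ L²(𝕋^d)` is represented by its sequence of Fourier coefficients
`û : ℤ^d → ℂ` (with respect to the orthonormal basis `ψ_k = (2π)^{-d/2} e^{ik·x}`),
and operators on `L²(γ_ω)` by their kernels (matrices) in the orthonormal basis
`φ_m^ω(s) = e^{ims/|p_ω|}/√(2π|p_ω|)`, `m ∈ ℤ`.
-/

noncomputable section

open MeasureTheory Filter
open scoped BigOperators ComplexConjugate Topology ENNReal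

namespace TorusSchrodinger

variable {d : ℕ}

/-- `|p_ω|²` is nonzero. -/
theorem ResonantDir.M_ne_zero (ω : ResonantDir d) : ω.M ≠ 0 := by
  intro hM
  apply ω.ne
  funext i
  have hsum : ∑ i, ω.p i * ω.p i = 0 := hM
  rw [Finset.sum_eq_zero_iff_of_nonneg fun i _ => mul_self_nonneg (ω.p i)] at hsum
  exact mul_self_eq_zero.mp (hsum i (Finset.mem_univ i))

/-- The image of `projPerp ω`, dilated, lies in the hyperplane `I_ω`. -/
theorem dotR_smul_projPerp (ω : ResonantDir d) (h : ℝ) (k : Zd d) :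
    dotR ω.p (h • projPerp ω k) = 0 := by
  have hM : (ω.M : ℝ) ≠ 0 := by exact_mod_cast ω.M_ne_zero
  have hMs : (ω.M : ℝ) = ∑ i, (ω.p i : ℝ) * ω.p i := by
    simp [ResonantDir.M, dotZ]
  have hks : (dotZ k ω.p : ℝ) = ∑ i, (k i : ℝ) * ω.p i := by
    simp [dotZ]
  calc dotR ω.p (h • projPerp ω k)
      = h * ((∑ i, (k i : ℝ) * ω.p i)
          - (dotZ k ω.p : ℝ) / ω.M * ∑ i, (ω.p i : ℝ) * ω.p i) := by
        rw [Finset.mul_sum, ← Finset.sum_sub_distrib, Finset.mul_sum]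
        refine Finset.sum_congr rfl fun i _ => ?_
        simp only [projPerp, toRd, Pi.smul_apply, Pi.sub_apply, smul_eq_mul]
        ring
    _ = 0 := by
        rw [← hMs, ← hks, div_mul_cancel₀ _ hM, sub_self, mul_zero]

theorem dotZ_add_smul (ω : ResonantDir d) (k : Zd d) (l : ℤ) :
    dotZ (k + l • ω.p) ω.p = dotZ k ω.p + l * ω.M := by
  simp only [dotZ, ResonantDir.M, Pi.add_apply, Pi.smul_apply, smul_eq_mul, Finset.mul_sum,
    ← Finset.sum_add_distrib]
  exact Finset.sum_congr rfl fun i _ => by ring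

/-- The mass of `u` on the frequencies `k` with `k·p_ω = m`. -/
def fiberMass (u : Zd d → ℂ) (ω : ResonantDir d) (m : ℤ) : ℝ :=
  ∑' k : {k : Zd d // dotZ k ω.p = m}, ‖u k.1‖ ^ 2

theorem fiberMass_nonneg (u : Zd d → ℂ) (ω : ResonantDir d) (m : ℤ) : 0 ≤ fiberMass u ω m :=
  tsum_nonneg fun _ => by positivity

theorem hasSum_fiberMass {u : Zd d → ℂ} (hu : Summable fun k => ‖u k‖ ^ 2) (ω : ResonantDir d) :
    HasSum (fiberMass u ω) (∑' k, ‖u k‖ ^ 2) :=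
  hu.hasSum.tsum_fiberwise fun k => dotZ k ω.p

/-- Cauchy–Schwarz for the norm of a sum of products. -/
theorem norm_tsum_mul_conj_sq_le {ι : Type*} {c f g : ι → ℂ} {B : ℝ} (hc : ∀ i, ‖c i‖ ≤ B)
    (hf : Summable fun i => ‖f i‖ ^ 2) (hg : Summable fun i => ‖g i‖ ^ 2) :
    ‖∑' i, c i * f i * conj (g i)‖ ^ 2 ≤
      B ^ 2 * ((∑' i, ‖f i‖ ^ 2) * ∑' i, ‖g i‖ ^ 2) := by
  have hle : ∀ i, ‖c i * f i * conj (g i)‖ ≤ B * (‖f i‖ * ‖g i‖) := fun i => by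
    rw [norm_mul, norm_mul, RCLike.norm_conj, mul_assoc]
    exact mul_le_mul_of_nonneg_right (hc i) (by positivity)
  have hCS := Real.summable_and_inner_le_Lp_mul_Lq_tsum_of_nonneg Real.HolderConjugate.two_two
    (fun i => norm_nonneg (f i)) (fun i => norm_nonneg (g i))
    (by simpa only [Real.rpow_two] using hf) (by simpa only [Real.rpow_two] using hg)
  simp only [Real.rpow_two, ← Real.sqrt_eq_rpow] at hCS
  obtain ⟨hs, hCS⟩ := hCS
  have hbound : ‖∑' i, c i * f i * conj (g i)‖ ≤ B * ∑' i, ‖f i‖ * ‖g i‖ :=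
    tsum_of_norm_bounded (hs.hasSum.mul_left B) hle
  have hnonneg : 0 ≤ ∑' i, ‖f i‖ * ‖g i‖ := tsum_nonneg fun _ => by positivity
  calc ‖∑' i, c i * f i * conj (g i)‖ ^ 2
      ≤ (B * ∑' i, ‖f i‖ * ‖g i‖) ^ 2 := pow_le_pow_left₀ (norm_nonneg _) hbound 2
    _ = B ^ 2 * (∑' i, ‖f i‖ * ‖g i‖) ^ 2 := mul_pow _ _ _
    _ ≤ B ^ 2 * (√(∑' i, ‖f i‖ ^ 2) * √(∑' i, ‖g i‖ ^ 2)) ^ 2 := by gcongr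
    _ = B ^ 2 * ((∑' i, ‖f i‖ ^ 2) * ∑' i, ‖g i‖ ^ 2) := by
        rw [mul_pow, Real.sq_sqrt (tsum_nonneg fun _ => by positivity),
          Real.sq_sqrt (tsum_nonneg fun _ => by positivity)]

theorem norm_kerKb_sq_le {u : Zd d → ℂ} (hu : Summable fun k => ‖u k‖ ^ 2) (h : ℝ)
    (ω : ResonantDir d) {b : Rd d → ℂ} {B : ℝ} (hb : ∀ ξ : Rd d, dotR ω.p ξ = 0 → ‖b ξ‖ ≤ B)
    (m n : ℤ) : ‖kerKb u h ω b m n‖ ^ 2 ≤ B ^ 2 * (fiberMass u ω m * fiberMass u ω n) := by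
  unfold kerKb
  split_ifs with hdvd
  · let shift : {k : Zd d // dotZ k ω.p = m} → {k : Zd d // dotZ k ω.p = n} := fun k =>
      ⟨k.1 + ((n - m) / ω.M) • ω.p, by
        rw [dotZ_add_smul, k.2, Int.ediv_mul_cancel hdvd, add_sub_cancel]⟩
    have hshift : Function.Injective shift := fun k l hkl =>
      Subtype.ext (add_right_cancel (congrArg Subtype.val hkl))
    have hm : Summable fun k : {k : Zd d // dotZ k ω.p = m} => ‖u k.1‖ ^ 2 :=
      hu.comp_injective Subtype.val_injective
    have hn : Summable fun k : {k : Zd d // dotZ k ω.p = n} => ‖u k.1‖ ^ 2 :=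
      hu.comp_injective Subtype.val_injective
    have hg : Summable fun k => ‖u (shift k).1‖ ^ 2 := hn.comp_injective hshift
    have hle : ∑' k, ‖u (shift k).1‖ ^ 2 ≤ fiberMass u ω n :=
      hg.tsum_le_tsum_of_inj shift hshift (fun _ _ => by positivity) (fun _ => le_rfl) hn
    refine (norm_tsum_mul_conj_sq_le (c := fun k : {k : Zd d // dotZ k ω.p = m} =>
      b (h • projPerp ω k.1)) (f := fun k => u k.1) (g := fun k => u (shift k).1)
      (fun k => hb _ (dotR_smul_projPerp ω h k.1)) hm hg).trans ?_
    exact mul_le_mul_of_nonneg_left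
      (mul_le_mul_of_nonneg_left hle (fiberMass_nonneg u ω m)) (sq_nonneg B)
  · rw [norm_zero, zero_pow two_ne_zero]
    exact mul_nonneg (sq_nonneg B) (mul_nonneg (fiberMass_nonneg u ω m) (fiberMass_nonneg u ω n))

/-- the Hilbert–Schmidt bound
`∑_{m ≡ n (mod |p_ω|²)} |k_b(m,n)|² ≤ ‖b‖²_{L^∞(I_ω)} ‖u‖⁴_{L²(𝕋^d)}` for the
matrix coefficients `k_b` of `K_b` (which vanish when `m ≢ n (mod |p_ω|²)`). -/
theorem statement8 {d : ℕ} (u : Zd d → ℂ) (hu : Summable fun k => ‖u k‖ ^ 2)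
    (h : ℝ) (hh : 0 < h) (ω : ResonantDir d)
    (b : Rd d → ℂ) (B : ℝ) (hb : ∀ ξ : Rd d, dotR ω.p ξ = 0 → ‖b ξ‖ ≤ B) :
    ∑' q : ℤ × ℤ, ‖kerKb u h ω b q.1 q.2‖ ^ 2 ≤ B ^ 2 * (∑' k, ‖u k‖ ^ 2) ^ 2 := by
  have hF := hasSum_fiberMass hu ω
  have hprod : HasSum (fun q : ℤ × ℤ => B ^ 2 * (fiberMass u ω q.1 * fiberMass u ω q.2))
      (B ^ 2 * (∑' k, ‖u k‖ ^ 2) ^ 2) := by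
    rw [sq (∑' k, ‖u k‖ ^ 2)]
    exact (hF.mul hF (hF.summable.mul_of_nonneg hF.summable (fiberMass_nonneg u ω)
      (fiberMass_nonneg u ω))).mul_left _
  have hle : ∀ q : ℤ × ℤ, ‖kerKb u h ω b q.1 q.2‖ ^ 2 ≤
      B ^ 2 * (fiberMass u ω q.1 * fiberMass u ω q.2) := fun q =>
    norm_kerKb_sq_le hu h ω hb q.1 q.2
  have hs := Summable.of_nonneg_of_le (fun _ => sq_nonneg _) hle hprod.summable
  exact hasSum_le hle hs.hasSum hprod

end TorusSchrodinger
end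
end

section
/- Let u ∈ L²(𝕋^d), h > 0, ω a resonant direction, N > 0, and φ ∈ C_c¹(ℝ^d). Then | Σ_{n∈ℤ, |n|≤N} Σ_{r∈ω_n^⊥} φ(hr) |û((n/|p_ω|)ν_ω + r)|² − Σ_{k∈ℤ^d, |p_ω·k|≤N} φ(hk) |û(k)|² | ≤ h N ‖∇φ‖_{L^∞} ‖u‖²_{L²(𝕋^d)}. -/
/-!
Setting (F. Macià, "High-frequency propagation for the Schrödinger equation on
the torus").

The flat torus `𝕋^d = ℝ^d/(2πℤ)^d` is modelled as `Fin d → AddCircle (2π)`; an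
element `u ∈ L²(𝕋^d)` is represented by its sequence of Fourier coefficients
`û : ℤ^d → ℂ` (with respect to the orthonormal basis `ψ_k = (2π)^{-d/2} e^{ik·x}`),
and operators on `L²(γ_ω)` by their kernels (matrices) in the orthonormal basis
`φ_m^ω(s) = e^{ims/|p_ω|}/√(2π|p_ω|)`, `m ∈ ℤ`.
-/

noncomputable section

open MeasureTheory Filter
open scoped BigOperators ComplexConjugate Topology ENNReal

namespace TorusSchrodinger

variable {d : ℕ}

theorem ResonantDir.M_pos_s13 (ω : ResonantDir d) : 0 < ω.M := by
  obtain ⟨i, hi⟩ := Function.ne_iff.mp ω.ne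
  exact Finset.sum_pos' (fun j _ => mul_self_nonneg (ω.p j))
    ⟨i, Finset.mem_univ i, mul_self_pos.mpr hi⟩

theorem ResonantDir.abs_le_M (ω : ResonantDir d) (i : Fin d) : |ω.p i| ≤ ω.M := by
  have hle : ω.p i * ω.p i ≤ ω.M :=
    Finset.single_le_sum (f := fun j => ω.p j * ω.p j)
      (fun j _ => mul_self_nonneg (ω.p j)) (Finset.mem_univ i)
  have hsq : |ω.p i| ≤ |ω.p i| ^ 2 := Int.le_self_sq _
  rw [sq_abs, sq] at hsq
  exact hsq.trans hle

/-- The component of a lattice point along `ω` is at most `|p_ω · k|` in the sup norm. -/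
theorem norm_projPerp_sub_toRd_le (ω : ResonantDir d) (k : Zd d) :
    ‖projPerp ω k - toRd k‖ ≤ |((dotZ k ω.p : ℤ) : ℝ)| := by
  have hM : (0 : ℝ) < ω.M := by exact_mod_cast ω.M_pos_s13
  have hp : ‖toRd ω.p‖ ≤ (ω.M : ℝ) := by
    refine (pi_norm_le_iff_of_nonneg hM.le).mpr fun i => ?_
    rw [Real.norm_eq_abs, toRd]
    exact_mod_cast ω.abs_le_M i
  rw [projPerp, sub_sub_cancel_left, norm_neg, norm_smul, Real.norm_eq_abs, abs_div,
    abs_of_pos hM, div_mul_eq_mul_div, div_le_iff₀ hM]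
  exact mul_le_mul_of_nonneg_left hp (abs_nonneg _)

/-- A compactly supported `C¹` function is Lipschitz with constant the supremum of `‖fderiv‖`. -/
theorem abs_sub_le_iSup_norm_fderiv {E : Type*} [NormedAddCommGroup E] [NormedSpace ℝ E]
    {φ : E → ℝ} (hφ : ContDiff ℝ 1 φ) (hφc : HasCompactSupport φ) (x y : E) :
    |φ x - φ y| ≤ (⨆ z, ‖fderiv ℝ φ z‖) * ‖x - y‖ := by
  obtain ⟨C, hC⟩ := (hφc.fderiv ℝ).exists_bound_of_continuous
    (hφ.continuous_fderiv one_ne_zero)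
  have hbdd : BddAbove (Set.range fun z => ‖fderiv ℝ φ z‖) :=
    ⟨C, by rintro _ ⟨z, rfl⟩; exact hC z⟩
  exact convex_univ.norm_image_sub_le_of_norm_fderiv_le
    (fun z _ => hφ.differentiable one_ne_zero z) (fun z _ => le_ciSup hbdd z)
    (Set.mem_univ y) (Set.mem_univ x)

/-- for `u ∈ L²(𝕋^d)`, `h > 0`, `N > 0` and `φ ∈ C_c¹(ℝ^d)`,
`|∑_{|n|≤N} ∑_{r∈ω_n^⊥} φ(hr)|û((n/|p_ω|)ν_ω+r)|² − ∑_{|p_ω·k|≤N} φ(hk)|û(k)|²|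
  ≤ hN ‖∇φ‖_∞ ‖u‖²_{L²}`.
(The first sum is written via the parametrisation of the pairs `(n, r)`,
`r ∈ ω_n^⊥`, by the lattice points `k` with `k·p_ω = n`, `r = projPerp ω k`.) -/
theorem statement13 {d : ℕ} (u : Zd d → ℂ) (hu : Summable fun k => ‖u k‖ ^ 2)
    (h : ℝ) (hh : 0 < h) (ω : ResonantDir d) (N : ℝ) (hN : 0 < N)
    (φ : Rd d → ℝ) (hφ : ContDiff ℝ 1 φ) (hφc : HasCompactSupport φ) :
    |(∑' k : {k : Zd d // |((dotZ k ω.p : ℤ) : ℝ)| ≤ N},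
        φ (h • projPerp ω k.1) * ‖u k.1‖ ^ 2) -
      ∑' k : {k : Zd d // |((dotZ k ω.p : ℤ) : ℝ)| ≤ N},
        φ (h • toRd k.1) * ‖u k.1‖ ^ 2|
      ≤ h * N * (⨆ x : Rd d, ‖fderiv ℝ φ x‖) * ∑' k, ‖u k‖ ^ 2 := by
  obtain ⟨C, hC⟩ := hφc.exists_bound_of_continuous hφ.continuous
  have hus : Summable fun k : {k : Zd d // |((dotZ k ω.p : ℤ) : ℝ)| ≤ N} => ‖u k.1‖ ^ 2 :=
    hu.subtype _
  have hsum (f : {k : Zd d // |((dotZ k ω.p : ℤ) : ℝ)| ≤ N} → Rd d) :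
      Summable fun k => φ (f k) * ‖u k.1‖ ^ 2 :=
    Summable.of_norm_bounded (hus.mul_left C) fun k => by
      rw [norm_mul, Real.norm_of_nonneg (sq_nonneg ‖u k.1‖)]
      exact mul_le_mul_of_nonneg_right (hC _) (sq_nonneg _)
  have hK : 0 ≤ ⨆ x : Rd d, ‖fderiv ℝ φ x‖ := Real.iSup_nonneg fun _ => norm_nonneg _
  have hterm (k : {k : Zd d // |((dotZ k ω.p : ℤ) : ℝ)| ≤ N}) :
      ‖φ (h • projPerp ω k.1) * ‖u k.1‖ ^ 2 - φ (h • toRd k.1) * ‖u k.1‖ ^ 2‖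
        ≤ h * N * (⨆ x : Rd d, ‖fderiv ℝ φ x‖) * ‖u k.1‖ ^ 2 := by
    rw [← sub_mul, norm_mul, Real.norm_of_nonneg (sq_nonneg ‖u k.1‖), Real.norm_eq_abs]
    refine mul_le_mul_of_nonneg_right ?_ (sq_nonneg _)
    calc |φ (h • projPerp ω k.1) - φ (h • toRd k.1)|
        ≤ (⨆ x : Rd d, ‖fderiv ℝ φ x‖) * ‖h • projPerp ω k.1 - h • toRd k.1‖ :=
          abs_sub_le_iSup_norm_fderiv hφ hφc _ _
      _ ≤ (⨆ x : Rd d, ‖fderiv ℝ φ x‖) * (h * N) := by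
          rw [← smul_sub, norm_smul, Real.norm_of_nonneg hh.le]
          gcongr
          exact (norm_projPerp_sub_toRd_le ω k.1).trans k.2
      _ = h * N * ⨆ x : Rd d, ‖fderiv ℝ φ x‖ := mul_comm _ _
  rw [← (hsum _).tsum_sub (hsum _)]
  calc _ ≤ ∑' k : {k : Zd d // |((dotZ k ω.p : ℤ) : ℝ)| ≤ N},
          h * N * (⨆ x : Rd d, ‖fderiv ℝ φ x‖) * ‖u k.1‖ ^ 2 :=
        tsum_of_norm_bounded (hus.mul_left _).hasSum hterm
    _ = h * N * (⨆ x : Rd d, ‖fderiv ℝ φ x‖) *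
          ∑' k : {k : Zd d // |((dotZ k ω.p : ℤ) : ℝ)| ≤ N}, ‖u k.1‖ ^ 2 := tsum_mul_left
    _ ≤ _ := by
        gcongr
        exact hu.tsum_subtype_le _ _ (fun _ => sq_nonneg _)

end TorusSchrodinger
end
end
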